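/- arXiv:1312.7544 — 3 statements merged into one kernel-verified Lean document; each statement's English description precedes it below -/
import Mathlib

section
/- Let 0 ≤ η̂ < 2/π and let u : ℝ → ℝ be a C² function which is 2π-periodic with zero average. Set g(t) := u''(t) + η̂·u'(t). Then ‖u‖ ≤ (1 + η̂·(π/2)·(1 − η̂·π/2)⁻¹) · (π²/8) · ‖g‖. -/
open Real

/-- Pairing with a kernel `p` bounds the integral by the `L¹` norm of `p` times a sup bound. -/
theorem abs_integral_mul_le_of_abs_le {p f : ℝ → ℝ} {a b M : ℝ} (hab : a ≤ b)
    (hp : Continuous p) (hf : Continuous f) (hM : ∀ t, |f t| ≤ M) :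
    |∫ s in a..b, p s * f s| ≤ (∫ s in a..b, |p s|) * M := by
  rw [← intervalIntegral.integral_mul_const]
  refine (intervalIntegral.abs_integral_le_integral_abs hab).trans ?_
  refine intervalIntegral.integral_mono_on hab ?_ ?_ fun s _ => ?_
  · exact (hp.mul hf).abs.intervalIntegrable _ _
  · exact (hp.abs.mul continuous_const).intervalIntegrable _ _
  · rw [abs_mul]
    exact mul_le_mul_of_nonneg_left (hM s) (abs_nonneg _)

theorem integral_abs_sub_pi : ∫ s in (0:ℝ)..(2 * π), |s - π| = π ^ 2 := by
  have hc : Continuous fun s : ℝ => |s - π| := by fun_prop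
  have h1 : ∫ s in (0:ℝ)..π, |s - π| = ∫ s in (0:ℝ)..π, (π - s) := by
    refine intervalIntegral.integral_congr fun s hs => ?_
    rw [Set.uIcc_of_le pi_pos.le] at hs
    exact (abs_of_nonpos (by linarith [hs.2])).trans (neg_sub s π)
  have h2 : ∫ s in π..(2 * π), |s - π| = ∫ s in π..(2 * π), (s - π) := by
    refine intervalIntegral.integral_congr fun s hs => ?_
    rw [Set.uIcc_of_le (by linarith [pi_pos])] at hs
    exact abs_of_nonneg (by linarith [hs.1])
  rw [← intervalIntegral.integral_add_adjacent_intervals (hc.intervalIntegrable 0 π)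
    (hc.intervalIntegrable π (2 * π)), h1, h2,
    intervalIntegral.integral_sub (by simp) (by simp),
    intervalIntegral.integral_sub (by simp) (by simp)]
  simp only [integral_id, intervalIntegral.integral_const, smul_eq_mul]
  ring

theorem integral_sq_sub_pi (a b : ℝ) :
    ∫ s in a..b, ((s - π) ^ 2 / 2 - π ^ 2 / 8) =
      ((b - π) ^ 3 / 6 - π ^ 2 / 8 * b) - ((a - π) ^ 3 / 6 - π ^ 2 / 8 * a) := by
  refine intervalIntegral.integral_eq_sub_of_hasDerivAt
    (f := fun s => (s - π) ^ 3 / 6 - π ^ 2 / 8 * s) (fun s _ => ?_)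
    (Continuous.intervalIntegrable (by fun_prop) _ _)
  have h := ((((hasDerivAt_id' s).sub_const π).pow 3).div_const 6).sub
    ((hasDerivAt_id' s).const_mul (π ^ 2 / 8))
  refine h.congr_deriv ?_
  norm_num
  ring

theorem integral_abs_sq_sub_pi :
    ∫ s in (0:ℝ)..(2 * π), |(s - π) ^ 2 / 2 - π ^ 2 / 8| = π ^ 3 / 4 := by
  have hπ := pi_pos
  have hc : Continuous fun s : ℝ => |(s - π) ^ 2 / 2 - π ^ 2 / 8| := by fun_prop
  have h1 : ∫ s in (0:ℝ)..(π / 2), |(s - π) ^ 2 / 2 - π ^ 2 / 8| =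
      ∫ s in (0:ℝ)..(π / 2), ((s - π) ^ 2 / 2 - π ^ 2 / 8) := by
    refine intervalIntegral.integral_congr fun s hs => ?_
    rw [Set.uIcc_of_le (by linarith)] at hs
    exact abs_of_nonneg (by nlinarith [hs.1, hs.2])
  have h2 : ∫ s in (π / 2)..(3 * π / 2), |(s - π) ^ 2 / 2 - π ^ 2 / 8| =
      -∫ s in (π / 2)..(3 * π / 2), ((s - π) ^ 2 / 2 - π ^ 2 / 8) := by
    rw [← intervalIntegral.integral_neg]
    refine intervalIntegral.integral_congr fun s hs => ?_
    rw [Set.uIcc_of_le (by linarith)] at hs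
    exact abs_of_nonpos (by nlinarith [mul_nonneg (sub_nonneg.2 hs.1) (sub_nonneg.2 hs.2)])
  have h3 : ∫ s in (3 * π / 2)..(2 * π), |(s - π) ^ 2 / 2 - π ^ 2 / 8| =
      ∫ s in (3 * π / 2)..(2 * π), ((s - π) ^ 2 / 2 - π ^ 2 / 8) := by
    refine intervalIntegral.integral_congr fun s hs => ?_
    rw [Set.uIcc_of_le (by linarith)] at hs
    exact abs_of_nonneg (by nlinarith [hs.1, hs.2])
  rw [← intervalIntegral.integral_add_adjacent_intervals
      (hc.intervalIntegrable 0 (3 * π / 2)) (hc.intervalIntegrable (3 * π / 2) (2 * π)),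
    ← intervalIntegral.integral_add_adjacent_intervals
      (hc.intervalIntegrable 0 (π / 2)) (hc.intervalIntegrable (π / 2) (3 * π / 2)),
    h1, h2, h3, integral_sq_sub_pi, integral_sq_sub_pi, integral_sq_sub_pi]
  ring

/-- A periodic function of zero average is recovered from its derivative by integrating against
the first Bernoulli kernel. -/
theorem integral_sub_pi_mul_deriv {v v' : ℝ → ℝ} (hv : ∀ t, HasDerivAt v (v' t) t)
    (hv' : Continuous v') (hper : Function.Periodic v (2 * π))
    (havg : ∫ t in (0:ℝ)..(2 * π), v t = 0) (t : ℝ) :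
    ∫ s in (0:ℝ)..(2 * π), (s - π) * v' (t + s) = 2 * π * v t := by
  have hvc : Continuous v := continuous_iff_continuousAt.2 fun t => (hv t).continuousAt
  have hparts := intervalIntegral.integral_mul_deriv_eq_deriv_mul
    (a := 0) (b := 2 * π) (u := fun s => s - π) (u' := fun _ => 1)
    (v := fun s => v (t + s)) (v' := fun s => v' (t + s))
    (fun s _ => (hasDerivAt_id' s).sub_const π) (fun s _ => (hv (t + s)).comp_const_add t s)
    (Continuous.intervalIntegrable (by fun_prop) _ _)
    (Continuous.intervalIntegrable (by fun_prop) _ _)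
  have hshift : ∫ s in (0:ℝ)..(2 * π), v (t + s) = 0 := by
    rw [intervalIntegral.integral_comp_add_left v t, add_zero,
      hper.intervalIntegral_add_eq t 0, zero_add, havg]
  simp only [one_mul, hshift, hper t, add_zero] at hparts
  rw [hparts]
  ring

/-- The second Bernoulli kernel, normalised by an additive constant to have least `L¹` norm. -/
theorem integral_sq_sub_pi_mul_deriv {w w' w'' : ℝ → ℝ} (hw : ∀ t, HasDerivAt w (w' t) t)
    (hw' : ∀ t, HasDerivAt w' (w'' t) t) (hw'' : Continuous w'')
    (hper : Function.Periodic w (2 * π)) (hper' : Function.Periodic w' (2 * π))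
    (havg : ∫ t in (0:ℝ)..(2 * π), w t = 0) (t : ℝ) :
    ∫ s in (0:ℝ)..(2 * π), ((s - π) ^ 2 / 2 - π ^ 2 / 8) * w'' (t + s) = -(2 * π * w t) := by
  have hc : Continuous w' := continuous_iff_continuousAt.2 fun t => (hw' t).continuousAt
  have hparts := intervalIntegral.integral_mul_deriv_eq_deriv_mul
    (a := 0) (b := 2 * π) (u := fun s => (s - π) ^ 2 / 2 - π ^ 2 / 8) (u' := fun s => s - π)
    (v := fun s => w' (t + s)) (v' := fun s => w'' (t + s))
    (fun s _ => by
      have h := ((((hasDerivAt_id' s).sub_const π).pow 2).div_const 2).sub_const (π ^ 2 / 8)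
      refine h.congr_deriv ?_
      norm_num)
    (fun s _ => (hw' (t + s)).comp_const_add t s)
    (Continuous.intervalIntegrable (by fun_prop) _ _)
    (Continuous.intervalIntegrable (by fun_prop) _ _)
  simp only [integral_sub_pi_mul_deriv hw hc hper havg t, hper' t, add_zero] at hparts
  rw [hparts]
  ring

/-- The Bohr–Favard inequality of order one. -/
theorem abs_le_of_abs_deriv_le {v v' : ℝ → ℝ} {M : ℝ} (hv : ∀ t, HasDerivAt v (v' t) t)
    (hv' : Continuous v') (hper : Function.Periodic v (2 * π))
    (havg : ∫ t in (0:ℝ)..(2 * π), v t = 0) (hM : ∀ t, |v' t| ≤ M) (t : ℝ) :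
    |v t| ≤ π / 2 * M := by
  have h := abs_integral_mul_le_of_abs_le (p := fun s => s - π) (f := fun s => v' (t + s))
    two_pi_pos.le (by fun_prop) (by fun_prop) fun s => hM (t + s)
  rw [integral_sub_pi_mul_deriv hv hv' hper havg t, integral_abs_sub_pi, abs_mul,
    abs_of_pos two_pi_pos] at h
  refine le_of_mul_le_mul_left (h.trans_eq ?_) two_pi_pos
  ring

/-- The Bohr–Favard inequality of order two. -/
theorem abs_le_of_abs_deriv_deriv_le {w w' w'' : ℝ → ℝ} {M : ℝ}
    (hw : ∀ t, HasDerivAt w (w' t) t)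
    (hw' : ∀ t, HasDerivAt w' (w'' t) t) (hw'' : Continuous w'')
    (hper : Function.Periodic w (2 * π)) (hper' : Function.Periodic w' (2 * π))
    (havg : ∫ t in (0:ℝ)..(2 * π), w t = 0) (hM : ∀ t, |w'' t| ≤ M) (t : ℝ) :
    |w t| ≤ π ^ 2 / 8 * M := by
  have h := abs_integral_mul_le_of_abs_le (p := fun s => (s - π) ^ 2 / 2 - π ^ 2 / 8)
    (f := fun s => w'' (t + s)) two_pi_pos.le (by fun_prop) (by fun_prop) fun s => hM (t + s)
  rw [integral_sq_sub_pi_mul_deriv hw hw' hw'' hper hper' havg t, integral_abs_sq_sub_pi, abs_neg,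
    abs_mul, abs_of_pos two_pi_pos] at h
  refine le_of_mul_le_mul_left (h.trans_eq ?_) two_pi_pos
  ring

theorem Function.Periodic.deriv_of_real {f : ℝ → ℝ} {c : ℝ} (hf : Function.Periodic f c) :
    Function.Periodic (deriv f) c := fun t => by
  rw [← deriv_comp_add_const, funext hf]

theorem Function.Periodic.bddAbove_range_abs {f : ℝ → ℝ} {c : ℝ} (hf : Function.Periodic f c)
    (hc : 0 < c) (hcont : Continuous f) : BddAbove (Set.range fun t => |f t|) := by
  have hper : Function.Periodic (fun t => |f t|) c := fun t => by simp only [hf t]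
  exact (hper.compact_of_continuous hc.ne' hcont.abs).bddAbove

theorem stmt_3 (η : ℝ) (hη0 : 0 ≤ η) (hη : η < 2 / π)
    (u : ℝ → ℝ) (hu : ContDiff ℝ 2 u)
    (hper : Function.Periodic u (2 * π))
    (havg : ∫ t in (0:ℝ)..(2 * π), u t = 0)
    (g : ℝ → ℝ) (hg : ∀ t, g t = deriv (deriv u) t + η * deriv u t) :
    (⨆ t : ℝ, |u t|) ≤ (1 + η * (π / 2) * (1 - η * π / 2)⁻¹) * (π ^ 2 / 8) * ⨆ t : ℝ, |g t| := by
  have hu1 : ContDiff ℝ 1 (deriv u) := hu.deriv'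
  have hd : ∀ t, HasDerivAt u (deriv u t) t := fun t =>
    (hu.differentiable two_ne_zero t).hasDerivAt
  have hd' : ∀ t, HasDerivAt (deriv u) (deriv (deriv u) t) t := fun t =>
    (hu1.differentiable one_ne_zero t).hasDerivAt
  have hc' : Continuous (deriv u) := hu1.continuous
  have hc'' : Continuous (deriv (deriv u)) := hu1.continuous_deriv le_rfl
  have hper' := hper.deriv_of_real
  have hper'' := hper'.deriv_of_real
  have havg' : ∫ t in (0:ℝ)..(2 * π), deriv u t = 0 := by
    rw [intervalIntegral.integral_eq_sub_of_hasDerivAt (fun t _ => hd t)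
      (hc'.intervalIntegrable _ _), hper.eq, sub_self]
  have hgc : Continuous g := by
    rw [funext hg]
    fun_prop
  have hgper : Function.Periodic g (2 * π) := fun t => by rw [hg, hg, hper' t, hper'' t]
  set G := ⨆ t, |g t|
  set D := ⨆ t, |deriv u t|
  have hG : ∀ t, |g t| ≤ G := le_ciSup (hgper.bddAbove_range_abs two_pi_pos hgc)
  have hD : ∀ t, |deriv u t| ≤ D := le_ciSup (hper'.bddAbove_range_abs two_pi_pos hc')
  have h2 : ∀ t, |deriv (deriv u) t| ≤ G + η * D := fun t => by
    have he : deriv (deriv u) t = g t - η * deriv u t := by rw [hg]; ring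
    rw [he]
    refine (abs_sub _ _).trans (add_le_add (hG t) ?_)
    rw [abs_mul, abs_of_nonneg hη0]
    exact mul_le_mul_of_nonneg_left (hD t) hη0
  have hDle : D ≤ π / 2 * (G + η * D) :=
    ciSup_le (abs_le_of_abs_deriv_le hd' hc'' hper' havg' h2)
  have hpos : 0 < 1 - η * π / 2 := by
    rw [lt_div_iff₀ pi_pos] at hη
    linarith
  have hD' : D ≤ π / 2 * G * (1 - η * π / 2)⁻¹ := by
    rw [← div_eq_mul_inv, le_div_iff₀ hpos]
    linarith
  refine ciSup_le fun t =>
    (abs_le_of_abs_deriv_deriv_le hd hd' hc'' hper hper' havg h2 t).trans ?_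
  calc π ^ 2 / 8 * (G + η * D)
      ≤ π ^ 2 / 8 * (G + η * (π / 2 * G * (1 - η * π / 2)⁻¹)) := by gcongr
    _ = _ := by ring
end

section
/- Let e ∈ [0,1) and let u(t) be the fixed point of the range equation: u is continuous, 2π-periodic with zero average, with sup_{t∈ℝ}|u(t)| ≤ R := (5/2)·ε̂/(1−e)³ for some ε̂ ≥ 0, and let ξ ∈ ℝ and p, q be nonzero integers. Then |(1/2π)·∫₀^{2π} f_x(ξ + p·t + u(t), q·t) dt − (1/2π)·∫₀^{2π} f_x(ξ + p·t, q·t) dt| ≤ 5·ε̂/(1−e)⁶. -/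
open Real

/-- The solution of Kepler's equation depends continuously on time. -/
theorem continuous_of_kepler {e : ℝ} (he : e ∈ Set.Ico (0 : ℝ) 1) {uE : ℝ → ℝ}
    (huE : ∀ t, t = uE t - e * Real.sin (uE t)) : Continuous uE := by
  have h1 : 0 < 1 - e := sub_pos.2 he.2
  refine (LipschitzWith.of_dist_le_mul (K := ⟨(1 - e)⁻¹, (inv_pos.2 h1).le⟩)
    fun t s => ?_).continuous
  change dist _ _ ≤ (1 - e)⁻¹ * _
  rw [Real.dist_eq, Real.dist_eq, inv_mul_eq_div, le_div_iff₀ h1]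
  have hsin := mul_le_mul_of_nonneg_left (abs_sin_sub_sin_le (uE t) (uE s)) he.1
  have heq : uE t - uE s = (t - s) + e * (Real.sin (uE t) - Real.sin (uE s)) := by
    linear_combination huE s - huE t
  have htri := abs_add_le (t - s) (e * (Real.sin (uE t) - Real.sin (uE s)))
  rw [← heq, abs_mul e, abs_of_nonneg he.1] at htri
  linarith

/-- A lower bound for the radius `1 - e cos u`. -/
theorem one_sub_le_one_sub_mul_cos {e : ℝ} (he : 0 ≤ e) (x : ℝ) :
    1 - e ≤ 1 - e * Real.cos x := by
  nlinarith [Real.cos_le_one x]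

theorem stmt_13 (e : ℝ) (he : e ∈ Set.Ico (0 : ℝ) 1)
    (uE : ℝ → ℝ) (huE : ∀ t, t = uE t - e * Real.sin (uE t))
    (fE : ℝ → ℝ)
    (hfEc : ∀ t, Real.cos (fE t) = (Real.cos (uE t) - e) / (1 - e * Real.cos (uE t)))
    (hfEs : ∀ t, Real.sin (fE t) =
      Real.sqrt (1 - e ^ 2) * Real.sin (uE t) / (1 - e * Real.cos (uE t)))
    (fx : ℝ → ℝ → ℝ)
    (hfx : ∀ x t, fx x t = Real.sin (2 * x - 2 * fE t) / (1 - e * Real.cos (uE t)) ^ 3)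
    (εh : ℝ) (hεh0 : 0 ≤ εh) (R : ℝ) (hR : R = (5 / 2) * εh / (1 - e) ^ 3)
    (u : ℝ → ℝ) (hu : Continuous u) (huper : Function.Periodic u (2 * π))
    (havg : ∫ t in (0:ℝ)..(2 * π), u t = 0) (hbd : ∀ t, |u t| ≤ R)
    (ξ : ℝ) (p q : ℤ) (hp : p ≠ 0) (hq : q ≠ 0) :
    |(1 / (2 * π)) * (∫ t in (0:ℝ)..(2 * π), fx (ξ + (p : ℝ) * t + u t) ((q : ℝ) * t)) -
     (1 / (2 * π)) * (∫ t in (0:ℝ)..(2 * π), fx (ξ + (p : ℝ) * t) ((q : ℝ) * t))|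
      ≤ 5 * εh / (1 - e) ^ 6 := by
  have h1 : 0 < 1 - e := sub_pos.2 he.2
  have hρ : ∀ t, 1 - e ≤ 1 - e * Real.cos (uE t) := fun t => one_sub_le_one_sub_mul_cos he.1 _
  have hρ0 : ∀ t, 1 - e * Real.cos (uE t) ≠ 0 := fun t => (h1.trans_le (hρ t)).ne'
  have huc : Continuous uE := continuous_of_kepler he huE
  have hcos : Continuous fun t => Real.cos (fE t) := by
    simp only [hfEc]
    exact Continuous.div (by fun_prop) (by fun_prop) hρ0
  have hsin : Continuous fun t => Real.sin (fE t) := by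
    simp only [hfEs]
    exact Continuous.div (by fun_prop) (by fun_prop) hρ0
  have hcont : ∀ g : ℝ → ℝ, Continuous g → Continuous fun t => fx (g t) ((q : ℝ) * t) := by
    intro g hg
    simp only [hfx, Real.sin_sub, Real.cos_two_mul (fE _), Real.sin_two_mul (fE _)]
    have hq' : Continuous fun t : ℝ => (q : ℝ) * t := by fun_prop
    have hc := hcos.comp hq'
    have hs := hsin.comp hq'
    simp only [Function.comp_def] at hc hs
    exact Continuous.div (by fun_prop) (by fun_prop) fun t => pow_ne_zero 3 (hρ0 _)
  have hptw : ∀ t, |fx (ξ + (p : ℝ) * t + u t) ((q : ℝ) * t) - fx (ξ + (p : ℝ) * t) ((q : ℝ) * t)|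
      ≤ 5 * εh / (1 - e) ^ 6 := by
    intro t
    have hb : 5 * εh / (1 - e) ^ 6 = 2 * R / (1 - e) ^ 3 := by
      rw [hR]; field_simp
    have hpos := h1.trans_le (hρ ((q : ℝ) * t))
    rw [hfx, hfx, ← sub_div, abs_div, abs_of_pos (pow_pos hpos 3), hb]
    have hR0 : 0 ≤ R := (abs_nonneg _).trans (hbd t)
    refine div_le_div₀ (by positivity) ?_ (pow_pos h1 3) (pow_le_pow_left₀ h1.le (hρ _) 3)
    refine (abs_sin_sub_sin_le _ _).trans ?_
    have : 2 * (ξ + (p : ℝ) * t + u t) - 2 * fE ((q : ℝ) * t)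
        - (2 * (ξ + (p : ℝ) * t) - 2 * fE ((q : ℝ) * t)) = 2 * u t := by ring
    rw [this, abs_mul, abs_two]
    linarith [hbd t]
  have hint := intervalIntegral.norm_integral_le_of_norm_le_const (a := 0) (b := 2 * π)
    fun t _ => (Real.norm_eq_abs _).trans_le (hptw t)
  rw [intervalIntegral.integral_sub ((hcont _ (by fun_prop)).intervalIntegrable _ _)
    ((hcont _ (by fun_prop)).intervalIntegrable _ _), Real.norm_eq_abs, sub_zero,
    abs_of_pos Real.two_pi_pos] at hint
  rw [← mul_sub, abs_mul, abs_of_pos (one_div_pos.2 Real.two_pi_pos), one_div, inv_mul_eq_div,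
    div_le_iff₀ Real.two_pi_pos]
  exact hint
end

section
/- Let e ∈ [0,1). Then for every ξ ∈ ℝ, (1/2π)·∫₀^{2π} f_x(ξ + 3t, 2t) dt = −2·α_3(e)·sin(2ξ), where the left-hand side (a real number) is regarded as a complex number. -/
open Real

theorem kepler_abs_sub_le {e : ℝ} (he : 0 ≤ e) (a b : ℝ) :
    (1 - e) * |a - b| ≤ |(a - e * sin a) - (b - e * sin b)| := by
  have h1 : |sin a - sin b| ≤ |a - b| := by
    simpa [Real.dist_eq] using Real.lipschitzWith_sin.dist_le_mul a b
  have h2 : |a - b| ≤ |(a - e * sin a) - (b - e * sin b)| + |e * (sin a - sin b)| := by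
    refine le_trans (le_of_eq ?_) (abs_add_le _ _)
    congr 1
    ring
  rw [abs_mul, abs_of_nonneg he] at h2
  nlinarith [mul_le_mul_of_nonneg_left h1 he]

theorem kepler_injective {e : ℝ} (he : e ∈ Set.Ico (0 : ℝ) 1) :
    Function.Injective fun u : ℝ => u - e * sin u := by
  intro a b hab
  have h := kepler_abs_sub_le he.1 a b
  rw [show (a - e * sin a) - (b - e * sin b) = 0 from sub_eq_zero.2 hab, abs_zero] at h
  have h' : |a - b| ≤ 0 := by
    by_contra! hpos
    nlinarith [mul_pos (sub_pos.2 he.2) hpos]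
  exact sub_eq_zero.1 (abs_nonpos_iff.1 h')

theorem continuous_of_kepler_s15 {e : ℝ} (he : e ∈ Set.Ico (0 : ℝ) 1) {u : ℝ → ℝ}
    (hu : ∀ t, t = u t - e * sin (u t)) : Continuous u := by
  have hpos : 0 < 1 - e := sub_pos.2 he.2
  refine (LipschitzWith.of_dist_le_mul (K := (1 - e)⁻¹.toNNReal) fun s t => ?_).continuous
  rw [Real.coe_toNNReal _ (inv_nonneg.2 hpos.le), Real.dist_eq, Real.dist_eq,
    inv_mul_eq_div, le_div_iff₀' hpos]
  simpa [← hu] using kepler_abs_sub_le he.1 (u s) (u t)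

theorem kepler_add_two_pi {e : ℝ} (he : e ∈ Set.Ico (0 : ℝ) 1) {u : ℝ → ℝ}
    (hu : ∀ t, t = u t - e * sin (u t)) (t : ℝ) : u (t + 2 * π) = u t + 2 * π := by
  apply kepler_injective he
  simp only [sin_add_two_pi]
  linarith [hu t, hu (t + 2 * π)]

theorem kepler_neg {e : ℝ} (he : e ∈ Set.Ico (0 : ℝ) 1) {u : ℝ → ℝ}
    (hu : ∀ t, t = u t - e * sin (u t)) (t : ℝ) : u (-t) = -u t := by
  apply kepler_injective he
  simp only [sin_neg]
  linarith [hu t, hu (-t)]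

theorem one_sub_mul_cos_pos {e : ℝ} (he : e ∈ Set.Ico (0 : ℝ) 1) (u : ℝ) :
    0 < 1 - e * cos u := by
  nlinarith [he.1, he.2, mul_le_mul_of_nonneg_left (cos_le_one u) he.1]

theorem Function.Periodic.intervalIntegral_eq_zero_of_odd {f : ℝ → ℝ} {T : ℝ}
    (hf : Function.Periodic f T) (hodd : ∀ x, f (-x) = -f x) : ∫ x in (0 : ℝ)..T, f x = 0 := by
  have h := intervalIntegral.integral_comp_sub_left (a := 0) (b := T) f T
  have h' : ∀ x, f (T - x) = -f x := fun x => by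
    rw [← hodd, ← hf (-x)]
    congr 1
    ring
  simp only [h', sub_self, sub_zero, intervalIntegral.integral_neg] at h
  linarith

theorem Function.Periodic.intervalIntegral_comp_two_mul {f : ℝ → ℝ} {T : ℝ}
    (hf : Function.Periodic f T) (hc : Continuous f) :
    ∫ x in (0 : ℝ)..T, f (2 * x) = ∫ x in (0 : ℝ)..T, f x := by
  rw [intervalIntegral.integral_comp_mul_left f two_ne_zero, mul_zero,
    ← intervalIntegral.integral_add_adjacent_intervals (hc.intervalIntegrable 0 T)
      (hc.intervalIntegrable T (2 * T)), two_mul, hf.intervalIntegral_add_eq T 0, zero_add,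
    smul_eq_mul]
  ring

theorem stmt_15 (e : ℝ) (he : e ∈ Set.Ico (0 : ℝ) 1)
    (uE : ℝ → ℝ) (huE : ∀ t, t = uE t - e * Real.sin (uE t))
    (fE : ℝ → ℝ)
    (hfEc : ∀ t, Real.cos (fE t) = (Real.cos (uE t) - e) / (1 - e * Real.cos (uE t)))
    (hfEs : ∀ t, Real.sin (fE t) =
      Real.sqrt (1 - e ^ 2) * Real.sin (uE t) / (1 - e * Real.cos (uE t)))
    (fx : ℝ → ℝ → ℝ)
    (hfx : ∀ x t, fx x t = Real.sin (2 * x - 2 * fE t) / (1 - e * Real.cos (uE t)) ^ 3)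
    (G : ℝ → ℂ)
    (hG : ∀ t, G t = -Complex.exp (2 * Complex.I * (fE t)) /
      (2 * ((1 - e * Real.cos (uE t) : ℝ) : ℂ) ^ 3))
    (α₃ : ℂ)
    (hα₃ : α₃ = (1 / (2 * π) : ℂ) *
      ∫ t in (0:ℝ)..(2 * π), G t * Complex.exp (-(3 : ℂ) * Complex.I * t)) :
    ∀ ξ : ℝ, (((1 / (2 * π)) * ∫ t in (0:ℝ)..(2 * π), fx (ξ + 3 * t) (2 * t) : ℝ) : ℂ) =
      -2 * α₃ * (Real.sin (2 * ξ) : ℂ) := by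
  have hu_cont := continuous_of_kepler_s15 he huE
  have hu_per := kepler_add_two_pi he huE
  have hu_neg := kepler_neg he huE
  have hρ : ∀ t, 1 - e * cos (uE t) ≠ 0 := fun t => (one_sub_mul_cos_pos he _).ne'
  have hc_cont : Continuous fun t => cos (fE t) := by
    simp only [hfEc]
    exact Continuous.div (by fun_prop) (by fun_prop) hρ
  have hs_cont : Continuous fun t => sin (fE t) := by
    simp only [hfEs]
    exact Continuous.div (by fun_prop) (by fun_prop) hρ
  have hc_per : ∀ t, cos (fE (t + 2 * π)) = cos (fE t) := by simp [hfEc, hu_per]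
  have hs_per : ∀ t, sin (fE (t + 2 * π)) = sin (fE t) := by simp [hfEs, hu_per]
  have hc_neg : ∀ t, cos (fE (-t)) = cos (fE t) := by simp [hfEc, hu_neg]
  have hs_neg : ∀ t, sin (fE (-t)) = -sin (fE t) := by simp [hfEs, hu_neg, neg_div]
  have h3_per : ∀ t : ℝ, 3 * (t + 2 * π) = 3 * t + (3 : ℕ) * (2 * π) := fun t => by
    push_cast
    ring
  set C : ℝ → ℝ := fun t => cos (3 * t - 2 * fE t) / (1 - e * cos (uE t)) ^ 3 with hC
  set S : ℝ → ℝ := fun t => sin (3 * t - 2 * fE t) / (1 - e * cos (uE t)) ^ 3 with hS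
  have hC_cont : Continuous C := by
    simp only [hC, cos_sub, cos_two_mul, sin_two_mul]
    exact Continuous.div (by fun_prop) (by fun_prop) fun t => pow_ne_zero 3 (hρ t)
  have hS_cont : Continuous S := by
    simp only [hS, sin_sub, cos_two_mul, sin_two_mul]
    exact Continuous.div (by fun_prop) (by fun_prop) fun t => pow_ne_zero 3 (hρ t)
  have hC_per : Function.Periodic C (2 * π) := fun t => by
    simp only [hC, cos_sub, cos_two_mul, sin_two_mul, hc_per, hs_per, hu_per, h3_per,
      cos_add_nat_mul_two_pi, sin_add_nat_mul_two_pi, cos_add_two_pi]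
  have hS_per : Function.Periodic S (2 * π) := fun t => by
    simp only [hS, sin_sub, cos_two_mul, sin_two_mul, hc_per, hs_per, hu_per, h3_per,
      cos_add_nat_mul_two_pi, sin_add_nat_mul_two_pi, cos_add_two_pi]
  have hS_odd : ∀ t, S (-t) = -S t := fun t => by
    simp only [hS, sin_sub, cos_two_mul, sin_two_mul, hc_neg, hs_neg, hu_neg, mul_neg, cos_neg,
      sin_neg]
    ring
  have hS_int := hS_per.intervalIntegral_eq_zero_of_odd hS_odd
  have hα : -2 * α₃ = ((1 / (2 * π) * ∫ t in (0 : ℝ)..(2 * π), C t : ℝ) : ℂ) := by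
    have hG_eq : ∀ t : ℝ, G t * Complex.exp (-(3 : ℂ) * Complex.I * t) =
        -(1 / 2) * (C t : ℂ) + Complex.I / 2 * (S t : ℂ) := fun t => by
      have hexp : Complex.exp (2 * Complex.I * fE t) * Complex.exp (-(3 : ℂ) * Complex.I * t) =
          cos (3 * t - 2 * fE t) - sin (3 * t - 2 * fE t) * Complex.I := by
        rw [← Complex.exp_add, show 2 * Complex.I * fE t + -(3 : ℂ) * Complex.I * t =
          ((-(3 * t - 2 * fE t) : ℝ) : ℂ) * Complex.I by push_cast; ring, Complex.exp_mul_I,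
          ← Complex.ofReal_cos, ← Complex.ofReal_sin, cos_neg, sin_neg]
        push_cast
        ring
      rw [hG, div_mul_eq_mul_div, neg_mul, hexp]
      simp only [hC, hS, Complex.ofReal_div, Complex.ofReal_pow]
      have := Complex.ofReal_ne_zero.2 (hρ t)
      field_simp
      ring
    have hCi : IntervalIntegrable (fun t => -(1 / 2) * (C t : ℂ)) MeasureTheory.volume
        0 (2 * π) := Continuous.intervalIntegrable (by fun_prop) _ _
    have hSi : IntervalIntegrable (fun t => Complex.I / 2 * (S t : ℂ)) MeasureTheory.volume
        0 (2 * π) := Continuous.intervalIntegrable (by fun_prop) _ _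
    simp only [hα₃, hG_eq]
    rw [intervalIntegral.integral_add hCi hSi, intervalIntegral.integral_const_mul,
      intervalIntegral.integral_const_mul, intervalIntegral.integral_ofReal,
      intervalIntegral.integral_ofReal, hS_int]
    push_cast
    ring
  intro ξ
  have hfx_eq : ∀ t, fx (ξ + 3 * t) (2 * t) =
      sin (2 * ξ) * C (2 * t) + cos (2 * ξ) * S (2 * t) := fun t => by
    rw [hfx, show 2 * (ξ + 3 * t) - 2 * fE (2 * t) = 2 * ξ + (3 * (2 * t) - 2 * fE (2 * t)) by ring,
      sin_add]
    simp only [hC, hS]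
    ring
  have hCi : IntervalIntegrable (fun t => sin (2 * ξ) * C (2 * t)) MeasureTheory.volume
      0 (2 * π) := Continuous.intervalIntegrable (by fun_prop) _ _
  have hSi : IntervalIntegrable (fun t => cos (2 * ξ) * S (2 * t)) MeasureTheory.volume
      0 (2 * π) := Continuous.intervalIntegrable (by fun_prop) _ _
  simp only [hfx_eq]
  rw [hα, intervalIntegral.integral_add hCi hSi, intervalIntegral.integral_const_mul,
    intervalIntegral.integral_const_mul, hC_per.intervalIntegral_comp_two_mul hC_cont,
    hS_per.intervalIntegral_comp_two_mul hS_cont, hS_int]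
  push_cast
  ring
end
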